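/- arXiv:2309.05352 — 2 statements merged into one kernel-verified Lean document; each statement's English description precedes it below -/
import Mathlib

section
/- Let n ≥ 1, 1 ≤ k ≤ n, B ⊆ {1,…,n} with |B| = k, and let γ(t) = (1, t, …, tⁿ) ∈ ℝ^{n+1}. A continuous function ψ : [0,1]ⁿ → ℝ is invariant under all permutations of the coordinates indexed by B (i.e., ψ(σ·x) = ψ(x) for every σ ∈ S_n fixing all indices outside B) if and only if there exists a continuous function ρ : ℝ^{n+1} × ℝ^{n-k} → ℝ such that ψ(x) = ρ(∑_{i ∈ B} γ(x_i), (x_j)_{j ∉ B}) for all x ∈ [0,1]ⁿ. -/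
/-- Over a commutative ring without zero divisors of characteristic zero, the power sums of degree
at most `m` determine the elementary symmetric polynomials of degree at most `m`. -/
theorem aeval_esymm_eq_of_aeval_psum_eq {σ R : Type*} [Fintype σ] [CommRing R] [IsDomain R]
    [CharZero R] {f g : σ → R} {m : ℕ}
    (h : ∀ j ≤ m, MvPolynomial.aeval f (MvPolynomial.psum σ R j) =
      MvPolynomial.aeval g (MvPolynomial.psum σ R j)) {j : ℕ} (hj : j ≤ m) :
    MvPolynomial.aeval f (MvPolynomial.esymm σ R j) =
      MvPolynomial.aeval g (MvPolynomial.esymm σ R j) := by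
  induction j using Nat.strong_induction_on with
  | _ j ih =>
    rcases Nat.eq_zero_or_pos j with rfl | hpos
    · simp
    · have newton (u : σ → R) :=
        congrArg (MvPolynomial.aeval u) (MvPolynomial.mul_esymm_eq_sum σ R j)
      simp only [map_mul, map_sum, map_pow, map_neg, map_one, map_natCast] at newton
      refine mul_left_cancel₀ (Nat.cast_ne_zero.mpr hpos.ne' : (j : R) ≠ 0) ?_
      rw [newton f, newton g]
      congr 1
      refine Finset.sum_congr rfl fun a ha => ?_
      obtain ⟨hsum, hlt⟩ := Finset.mem_filter.mp ha
      rw [Finset.HasAntidiagonal.mem_antidiagonal] at hsum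
      rw [ih a.1 hlt (by lia), h a.2 (by lia)]

/-- Multisets of the same size are determined by their elementary symmetric functions. -/
theorem Multiset.eq_of_esymm_eq {R : Type*} [CommRing R] [IsDomain R] {s t : Multiset R}
    (hcard : s.card = t.card) (h : ∀ j ≤ s.card, s.esymm j = t.esymm j) : s = t := by
  rw [← Polynomial.roots_multiset_prod_X_sub_C s, ← Polynomial.roots_multiset_prod_X_sub_C t,
    Multiset.prod_X_sub_X_eq_sum_esymm, Multiset.prod_X_sub_X_eq_sum_esymm, ← hcard]
  congr 1
  refine Finset.sum_congr rfl fun j hj => ?_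
  rw [h j (Nat.lt_succ_iff.mp (Finset.mem_range.mp hj))]

/-- Two families with the same multiset of values differ by a permutation of the index type. -/
theorem exists_perm_of_map_univ_eq {ι α : Type*} [Fintype ι] {f g : ι → α}
    (h : Finset.univ.val.map f = Finset.univ.val.map g) :
    ∃ e : Equiv.Perm ι, ∀ i, g (e i) = f i := by
  classical
  have hfiber (c : α) : Nonempty ({i // f i = c} ≃ {i // g i = c}) := by
    rw [← Fintype.card_eq, Fintype.card_subtype, Fintype.card_subtype]
    simpa [Multiset.count_map, Finset.card_def, eq_comm] using congrArg (Multiset.count c) h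
  exact ⟨Equiv.ofFiberEquiv fun c => (hfiber c).some, fun i => Equiv.ofFiberEquiv_map _ i⟩

/-- Families whose power sums up to the number of indices agree differ by a permutation. -/
theorem exists_perm_of_sum_pow_eq {ι R : Type*} [Fintype ι] [CommRing R] [IsDomain R] [CharZero R]
    {f g : ι → R} (h : ∀ j ≤ Fintype.card ι, ∑ i, f i ^ j = ∑ i, g i ^ j) :
    ∃ e : Equiv.Perm ι, ∀ i, g (e i) = f i := by
  refine exists_perm_of_map_univ_eq (Multiset.eq_of_esymm_eq (by simp) fun j hj => ?_)
  rw [← MvPolynomial.aeval_esymm_eq_multiset_esymm ι R,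
    ← MvPolynomial.aeval_esymm_eq_multiset_esymm ι R]
  refine aeval_esymm_eq_of_aeval_psum_eq (m := Fintype.card ι) (fun l hl => ?_) (by simpa using hj)
  simpa [MvPolynomial.psum] using h l hl

/-- A continuous real function on a compact set that is constant on the fibres of a continuous map
into a normal Hausdorff space factors through that map by a globally defined continuous function. -/
theorem IsCompact.exists_continuous_factor {X Y : Type*} [TopologicalSpace X] [TopologicalSpace Y]
    [T2Space Y] [NormalSpace Y] {K : Set X} (hK : IsCompact K) {F : X → Y} (hF : ContinuousOn F K)
    {ψ : X → ℝ} (hψ : ContinuousOn ψ K)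
    (h : ∀ x ∈ K, ∀ y ∈ K, F x = F y → ψ x = ψ y) :
    ∃ ρ : Y → ℝ, Continuous ρ ∧ ∀ x ∈ K, ψ x = ρ (F x) := by
  have : CompactSpace K := isCompact_iff_compactSpace.mp hK
  let p : C(K, F '' K) :=
    ⟨fun x => ⟨F x, x, x.2, rfl⟩, (continuousOn_iff_continuous_domRestrict.mp hF).subtype_mk _⟩
  let φ : C(K, ℝ) := ⟨fun x => ψ x, continuousOn_iff_continuous_domRestrict.mp hψ⟩
  have hp : Topology.IsQuotientMap p :=
    p.continuous.isClosedMap.isQuotientMap p.continuous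
      fun ⟨_, x, hx, hxy⟩ => ⟨⟨x, hx⟩, Subtype.ext hxy⟩
  have hφ : Function.FactorsThrough φ p := fun x y hxy =>
    h x x.2 y y.2 (congrArg Subtype.val hxy)
  obtain ⟨ρ, hρ⟩ := (hp.lift φ hφ).exists_restrict_eq (hK.image_of_continuousOn hF).isClosed
  refine ⟨ρ, ρ.continuous, fun x hx => ?_⟩
  have hlift := DFunLike.congr_fun (hp.lift_comp φ hφ) ⟨x, hx⟩
  have hext := DFunLike.congr_fun hρ (p ⟨x, hx⟩)
  exact hlift.symm.trans hext.symm


/-- A continuous `ψ : [0,1]ⁿ → ℝ` is invariant under all permutations of the coordinates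
indexed by `B` (with `|B| = k`) iff
`ψ x = ρ (∑_{i ∈ B} γ(x i), (x j)_{j ∉ B})` for some continuous `ρ`, where the
coordinates outside `B` are listed in increasing index order and `γ t = (1, t, …, tⁿ)`. -/
theorem statement6 (n k : ℕ) (hk1 : 1 ≤ k) (hkn : k ≤ n) (B : Finset (Fin n))
    (hB : B.card = k) (ψ : (Fin n → ℝ) → ℝ)
    (hψ : ContinuousOn ψ (Set.Icc (0 : Fin n → ℝ) 1)) :
    (∀ σ : Equiv.Perm (Fin n), (∀ i : Fin n, i ∉ B → σ i = i) →
        ∀ x ∈ Set.Icc (0 : Fin n → ℝ) 1, ψ (fun i => x (σ⁻¹ i)) = ψ x) ↔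
      ∃ ρ : (Fin (n + 1) → ℝ) × (Fin (n - k) → ℝ) → ℝ, Continuous ρ ∧
        ∀ x ∈ Set.Icc (0 : Fin n → ℝ) 1,
          ψ x = ρ (∑ i ∈ B, fun j : Fin (n + 1) => x i ^ (j : ℕ),
            fun j : Fin (n - k) =>
              x (Bᶜ.orderEmbOfFin (by simp [Finset.card_compl, hB]) j)) := by
  have hcard : Bᶜ.card = n - k := by simp [Finset.card_compl, hB]
  constructor
  · intro hinv
    refine isCompact_Icc.exists_continuous_factor
      (F := fun x : Fin n → ℝ => (∑ i ∈ B, fun j : Fin (n + 1) => x i ^ (j : ℕ),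
        fun j : Fin (n - k) => x (Bᶜ.orderEmbOfFin hcard j)))
      (by fun_prop) hψ fun x hx y _ hxy => ?_
    obtain ⟨hsum, hrest⟩ := Prod.ext_iff.mp hxy
    obtain ⟨e, he⟩ := exists_perm_of_sum_pow_eq (f := fun i : B => x i) (g := fun i : B => y i)
      fun j hj => by
        rw [Fintype.card_coe, hB] at hj
        have hj' := congrFun hsum ⟨j, by lia⟩
        simp only [Finset.sum_apply] at hj'
        rwa [Finset.sum_coe_sort B fun i => x i ^ j, Finset.sum_coe_sort B fun i => y i ^ j]
    have hfix : ∀ i ∉ B, Equiv.Perm.ofSubtype e i = i := fun i hi =>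
      Equiv.Perm.ofSubtype_apply_of_not_mem e hi
    have hyx (i : Fin n) : y (Equiv.Perm.ofSubtype e i) = x i := by
      by_cases hi : i ∈ B
      · rw [Equiv.Perm.ofSubtype_apply_of_mem e hi]
        exact he ⟨i, hi⟩
      · obtain ⟨j, rfl⟩ : i ∈ Set.range (Bᶜ.orderEmbOfFin hcard) := by simpa using hi
        rw [hfix _ hi]
        exact (congrFun hrest j).symm
    rw [← hinv _ hfix x hx]
    congr 1
    ext i
    simp [← hyx]
  · rintro ⟨ρ, -, hρ⟩ σ hσ x hx
    rw [hρ x hx, hρ (fun i => x (σ⁻¹ i)) ⟨fun i => hx.1 (σ⁻¹ i), fun i => hx.2 (σ⁻¹ i)⟩]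
    have hinv : ∀ i ∉ B, σ⁻¹ i = i := fun i hi => Equiv.Perm.inv_eq_iff_eq.mpr (hσ i hi).symm
    congr 2
    · exact Equiv.Perm.sum_comp σ⁻¹ B (fun i => fun j : Fin (n + 1) => x i ^ (j : ℕ))
        fun i hi => by_contra fun hiB => hi (hinv i hiB)
    · ext j
      rw [hinv _ (Finset.mem_compl.mp (Finset.orderEmbOfFin_mem _ _ j))]
end

section
/- Let n ≥ 1, 1 ≤ k ≤ n, γ(t) = (1, t, …, tⁿ) ∈ ℝ^{n+1}, M the projection onto the first k coordinates of ℝⁿ, and X^{(n:k)} = {x ∈ [0,1]ⁿ : x_1 ≤ … ≤ x_k}. Then the map F : X^{(n:k)} → ℝⁿ × ℝ^{n+1}, F(x) = ((I − M)x, ∑_{i=1}^{n} γ((Mx)_i)), is injective and a homeomorphism from X^{(n:k)} onto its image. -/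
/-- The map `F x = ((I − M) x, ∑_{i=1}^n γ((M x) i))`, where `M` projects onto the first
`k` coordinates and `γ t = (1, t, …, tⁿ)`. -/
noncomputable def mapF (n k : ℕ) (x : Fin n → ℝ) :
    (Fin n → ℝ) × (Fin (n + 1) → ℝ) :=
  (fun i : Fin n => if (i : ℕ) < k then 0 else x i,
   ∑ i : Fin n, fun j : Fin (n + 1) => (if (i : ℕ) < k then x i else 0) ^ (j : ℕ))

/-- The elementary symmetric functions of two tuples agree up to degree `m` as soon as their
power sums do. -/
theorem aeval_esymm_eq_of_sum_pow_eq {σ : Type*} [Fintype σ] {y z : σ → ℝ} {m : ℕ}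
    (h : ∀ j, 1 ≤ j → j ≤ m → ∑ i, y i ^ j = ∑ i, z i ^ j) {j : ℕ} (hj : j ≤ m) :
    MvPolynomial.aeval y (MvPolynomial.esymm σ ℝ j) =
      MvPolynomial.aeval z (MvPolynomial.esymm σ ℝ j) := by
  induction j using Nat.strong_induction_on with
  | _ j ih =>
    rcases Nat.eq_zero_or_pos j with rfl | hpos
    · simp
    have hj0 : (j : ℝ) ≠ 0 := by positivity
    apply mul_left_cancel₀ hj0
    have newton (w : σ → ℝ) := congrArg (MvPolynomial.aeval w)
      (MvPolynomial.mul_esymm_eq_sum σ ℝ j)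
    simp only [map_mul, map_natCast, map_sum, map_pow, map_neg, map_one] at newton
    rw [newton y, newton z]
    congr 1
    refine Finset.sum_congr rfl fun a ha => ?_
    rw [Finset.mem_filter] at ha
    have hadd : a.1 + a.2 = j := Finset.HasAntidiagonal.mem_antidiagonal.mp ha.1
    have hpsum : MvPolynomial.aeval y (MvPolynomial.psum σ ℝ a.2) =
        MvPolynomial.aeval z (MvPolynomial.psum σ ℝ a.2) := by
      simpa [MvPolynomial.psum] using h a.2 (by omega) (by omega)
    rw [ih a.1 ha.2 (by omega), hpsum]

/-- Two real tuples with the same power sums up to their length have the same multiset of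
values. -/
theorem map_univ_eq_of_sum_pow_eq {σ : Type*} [Fintype σ] {y z : σ → ℝ}
    (h : ∀ j, 1 ≤ j → j ≤ Fintype.card σ → ∑ i, y i ^ j = ∑ i, z i ^ j) :
    Finset.univ.val.map y = Finset.univ.val.map z := by
  rw [← Polynomial.roots_multiset_prod_X_sub_C (Finset.univ.val.map y),
    ← Polynomial.roots_multiset_prod_X_sub_C (Finset.univ.val.map z)]
  congr 1
  rw [Multiset.prod_X_sub_X_eq_sum_esymm, Multiset.prod_X_sub_X_eq_sum_esymm]
  simp only [Multiset.card_map]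
  refine Finset.sum_congr rfl fun j hj => ?_
  have hj' : j ≤ Fintype.card σ := Nat.lt_succ_iff.mp (Finset.mem_range.mp hj)
  have hesymm := aeval_esymm_eq_of_sum_pow_eq h hj'
  rw [MvPolynomial.aeval_esymm_eq_multiset_esymm,
    MvPolynomial.aeval_esymm_eq_multiset_esymm] at hesymm
  rw [hesymm]

/-- A monotone tuple is determined by its multiset of values. -/
theorem Monotone.eq_of_map_univ_eq {α : Type*} [PartialOrder α] {k : ℕ} {y z : Fin k → α}
    (hy : Monotone y) (hz : Monotone z)
    (h : Finset.univ.val.map y = Finset.univ.val.map z) : y = z := by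
  rw [Fin.univ_val_map, Fin.univ_val_map, Multiset.coe_eq_coe] at h
  exact List.ofFn_injective (h.eq_of_sortedLE hy.sortedLE_ofFn hz.sortedLE_ofFn)

theorem continuous_mapF (n k : ℕ) : Continuous (mapF n k) := by
  unfold mapF
  refine Continuous.prodMk (continuous_pi fun i => ?_)
    (continuous_finsetSum _ fun i _ => continuous_pi fun j => Continuous.pow ?_ _)
  · split_ifs <;> fun_prop
  · split_ifs <;> fun_prop

theorem isCompact_Icc_inter_monotone_initial (n k : ℕ) :
    IsCompact {x : Fin n → ℝ | x ∈ Set.Icc (0 : Fin n → ℝ) 1 ∧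
      ∀ i j : Fin n, (j : ℕ) < k → i ≤ j → x i ≤ x j} := by
  refine isCompact_Icc.inter_right (t := {x : Fin n → ℝ |
    ∀ i j : Fin n, (j : ℕ) < k → i ≤ j → x i ≤ x j}) ?_
  simp only [Set.ofPred_forall]
  exact isClosed_iInter fun i => isClosed_iInter fun j => isClosed_iInter fun _ =>
    isClosed_iInter fun _ => isClosed_le (continuous_apply i) (continuous_apply j)

/-- Positive-degree power sums of a tuple truncated to its first `k` entries. -/
theorem sum_ite_lt_pow {n k : ℕ} (hkn : k ≤ n) (x : Fin n → ℝ) {j : ℕ} (hj : j ≠ 0) :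
    ∑ i : Fin n, (if (i : ℕ) < k then x i else 0) ^ j = ∑ i : Fin k, x (Fin.castLE hkn i) ^ j := by
  obtain ⟨d, rfl⟩ := Nat.exists_eq_add_of_le hkn
  rw [Fin.sum_univ_add]
  simp [hj]
  rfl

theorem mapF_injOn {n k : ℕ} (hkn : k ≤ n) :
    Set.InjOn (mapF n k) {x | ∀ i j : Fin n, (j : ℕ) < k → i ≤ j → x i ≤ x j} := by
  intro x hx y hy hxy
  have mono {w : Fin n → ℝ} (hw : ∀ i j : Fin n, (j : ℕ) < k → i ≤ j → w i ≤ w j) :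
      Monotone (w ∘ Fin.castLE hkn) := fun i j hij => hw _ _ j.isLt hij
  have hsum (j : ℕ) (hj1 : 1 ≤ j) (hjk : j ≤ Fintype.card (Fin k)) :
      ∑ i, (x ∘ Fin.castLE hkn) i ^ j = ∑ i, (y ∘ Fin.castLE hkn) i ^ j := by
    rw [Fintype.card_fin] at hjk
    have hcoord := congrFun (congrArg Prod.snd hxy) ⟨j, by omega⟩
    simp only [mapF, Finset.sum_apply] at hcoord
    rwa [sum_ite_lt_pow hkn x (by omega), sum_ite_lt_pow hkn y (by omega)] at hcoord
  have hinit := (mono hx).eq_of_map_univ_eq (mono hy) (map_univ_eq_of_sum_pow_eq hsum)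
  funext i
  by_cases hi : (i : ℕ) < k
  · exact congrFun hinit ⟨i, hi⟩
  · simpa [mapF, hi] using congrFun (congrArg Prod.fst hxy) i

/-- On `X^{(n:k)} = {x ∈ [0,1]ⁿ : x_1 ≤ … ≤ x_k}`, the map `F` is injective and a
homeomorphism onto its image (i.e. a topological embedding). -/
theorem statement9 (n k : ℕ) (hk1 : 1 ≤ k) (hkn : k ≤ n) :
    Function.Injective
        (fun x : {x : Fin n → ℝ // x ∈ Set.Icc (0 : Fin n → ℝ) 1 ∧
            ∀ i j : Fin n, (j : ℕ) < k → i ≤ j → x i ≤ x j} => mapF n k x.1) ∧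
      Topology.IsEmbedding
        (fun x : {x : Fin n → ℝ // x ∈ Set.Icc (0 : Fin n → ℝ) 1 ∧
            ∀ i j : Fin n, (j : ℕ) < k → i ≤ j → x i ≤ x j} => mapF n k x.1) := by
  have hinj : Function.Injective
      (fun x : {x : Fin n → ℝ // x ∈ Set.Icc (0 : Fin n → ℝ) 1 ∧
        ∀ i j : Fin n, (j : ℕ) < k → i ≤ j → x i ≤ x j} => mapF n k x.1) :=
    fun x y hxy => Subtype.ext (mapF_injOn hkn x.2.2 y.2.2 hxy)
  have : CompactSpace {x : Fin n → ℝ // x ∈ Set.Icc (0 : Fin n → ℝ) 1 ∧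
      ∀ i j : Fin n, (j : ℕ) < k → i ≤ j → x i ≤ x j} :=
    isCompact_iff_compactSpace.mp (isCompact_Icc_inter_monotone_initial n k)
  exact ⟨hinj, (((continuous_mapF n k).comp continuous_subtype_val).isClosedEmbedding
    hinj).isEmbedding⟩
end
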